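/- arXiv:2010.05065 — 3 statements merged into one kernel-verified Lean document; each statement's English description precedes it below -/
import Mathlib

section
/- (Expander mixing lemma.) Let G be a d-regular graph on n vertices whose second largest absolute adjacency eigenvalue is at most λ. Then for every two subsets A and B of V(G), |e(A,B) − (d/n)|A||B|| ≤ λ·√(|A||B|(1 − |A|/n)(1 − |B|/n)). -/
open Finset

/-- The adjacency matrix of a simple graph over `ℝ` is Hermitian. -/
theorem adjMatrix_isHermitian {V : Type*} [Fintype V] (G : SimpleGraph V)
    [DecidableRel G.Adj] : (G.adjMatrix ℝ).IsHermitian := by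
  unfold Matrix.IsHermitian
  rw [Matrix.conjTranspose_eq_transpose_of_trivial]
  exact G.isSymm_adjMatrix

/-- The second largest absolute eigenvalue of the adjacency matrix of `G`:
if the eigenvalues are `λ₁ ≥ λ₂ ≥ ... ≥ λₙ`, this is `max_{2 ≤ i ≤ n} |λᵢ|`
(interpreted as `0` when `n ≤ 1`). -/
noncomputable def sndAbsEig {V : Type*} [Fintype V] [DecidableEq V] (G : SimpleGraph V)
    [DecidableRel G.Adj] : ℝ :=
  (((((Multiset.map (adjMatrix_isHermitian G).eigenvalues Finset.univ.val).sort (· ≤ ·)).dropLast).map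
    (fun x => |x|)).foldr max 0)

/-- `eAB G A B` is the number of edges of `G` with one end in `A` and the other end in `B`,
where edges with both ends in `A ∩ B` are counted twice. -/
def eAB {V : Type*} (G : SimpleGraph V) [DecidableRel G.Adj] (A B : Finset V) : ℕ :=
  ∑ a ∈ A, ∑ b ∈ B, if G.Adj a b then 1 else 0

/-- `eIn G A` is the number of edges of `G` with both ends in `A`. -/
noncomputable def eIn {V : Type*} [Fintype V] [DecidableEq V] (G : SimpleGraph V)
    [DecidableRel G.Adj] (A : Finset V) : ℕ :=
  letI := Classical.dec
  (G.edgeFinset.filter (fun e => ∀ v ∈ e, v ∈ A)).card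

/-- The number of connected components of the graph obtained from `G`
by deleting the vertices of `S`. -/
noncomputable def numComp {V : Type*} [Fintype V] [DecidableEq V] (G : SimpleGraph V)
    (S : Finset V) : ℕ :=
  Nat.card (G.induce ((Sᶜ : Finset V) : Set V)).ConnectedComponent

theorem List.le_foldr_max_of_mem {α : Type*} [LinearOrder α] (b : α) {l : List α} {x : α}
    (hx : x ∈ l) : x ≤ l.foldr max b := by
  induction l with
  | nil => simp at hx
  | cons y l ih =>
    rcases List.mem_cons.1 hx with rfl | h
    · exact le_max_left _ _
    · exact (ih h).trans (le_max_right _ _)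

theorem List.le_foldr_max {α : Type*} [LinearOrder α] (b : α) (l : List α) :
    b ≤ l.foldr max b := by
  induction l with
  | nil => exact le_rfl
  | cons y l ih => exact ih.trans (le_max_right _ _)

theorem sndAbsEig_nonneg {V : Type*} [Fintype V] [DecidableEq V] (G : SimpleGraph V)
    [DecidableRel G.Adj] : 0 ≤ sndAbsEig G :=
  List.le_foldr_max _ _

/-- Dropping the last entry of the sorted list of values of `f` removes a single index. -/
theorem exists_forall_ne_mem_dropLast_sort {ι : Type*} [Fintype ι] [DecidableEq ι] [Nonempty ι]
    (f : ι → ℝ) :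
    ∃ i₀, ∀ i, i ≠ i₀ → f i ∈ ((Multiset.map f univ.val).sort (· ≤ ·)).dropLast := by
  set l := (Multiset.map f univ.val).sort (· ≤ ·)
  have hcoe : (l : Multiset ℝ) = Multiset.map f univ.val := Multiset.sort_eq _ _
  have hne : l ≠ [] := by
    intro h
    rw [h] at hcoe
    have := congrArg Multiset.card hcoe
    exact Fintype.card_ne_zero (α := ι) (by simpa using this.symm)
  have hlast : l.getLast hne ∈ Multiset.map f univ.val := by
    rw [← hcoe]
    exact List.getLast_mem hne
  obtain ⟨i₀, -, hi₀⟩ := Multiset.mem_map.1 hlast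
  refine ⟨i₀, fun i hi => ?_⟩
  have h1 : (l : Multiset ℝ) = f i₀ ::ₘ (l.dropLast : Multiset ℝ) := by
    conv_lhs => rw [← List.dropLast_append_getLast hne]
    rw [hi₀, ← Multiset.coe_add, Multiset.coe_singleton, add_comm, Multiset.singleton_add]
  have h2 : Multiset.map f univ.val = f i₀ ::ₘ Multiset.map f (univ.val.erase i₀) := by
    rw [← Multiset.map_cons, Multiset.cons_erase (Finset.mem_univ i₀)]
  have h3 : (l.dropLast : Multiset ℝ) = Multiset.map f (univ.val.erase i₀) := by
    rw [← Multiset.cons_inj_right (f i₀), ← h1, ← h2, hcoe]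
  rw [← Multiset.mem_coe, h3]
  exact Multiset.mem_map_of_mem f ((Multiset.mem_erase_of_ne hi).2 (Finset.mem_univ i))

theorem exists_forall_ne_abs_eigenvalues_le_sndAbsEig {V : Type*} [Fintype V] [DecidableEq V]
    [Nonempty V] (G : SimpleGraph V) [DecidableRel G.Adj] :
    ∃ i₀, ∀ i, i ≠ i₀ → |(adjMatrix_isHermitian G).eigenvalues i| ≤ sndAbsEig G := by
  obtain ⟨i₀, h⟩ := exists_forall_ne_mem_dropLast_sort (adjMatrix_isHermitian G).eigenvalues
  exact ⟨i₀, fun i hi => List.le_foldr_max_of_mem _ (List.mem_map_of_mem (h i hi))⟩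

theorem sum_adjMatrix_row {V : Type*} [Fintype V] (G : SimpleGraph V) [DecidableRel G.Adj]
    {d : ℕ} (hreg : G.IsRegularOfDegree d) (v : V) : ∑ x, G.adjMatrix ℝ v x = d := by
  simp only [SimpleGraph.adjMatrix_apply, Finset.sum_boole]
  rw [← hreg v, ← SimpleGraph.card_neighborFinset_eq_degree, SimpleGraph.neighborFinset_eq_filter]

theorem abs_eigenvalues_adjMatrix_le {V : Type*} [Fintype V] [DecidableEq V] (G : SimpleGraph V)
    [DecidableRel G.Adj] {d : ℕ} (hreg : G.IsRegularOfDegree d) (i : V) :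
    |(adjMatrix_isHermitian G).eigenvalues i| ≤ d := by
  set hM := adjMatrix_isHermitian G
  have hev : Module.End.HasEigenvalue (Matrix.toLin' (G.adjMatrix ℝ)) (hM.eigenvalues i) := by
    rw [Module.End.hasEigenvalue_iff_mem_spectrum, Matrix.spectrum_toLin']
    exact hM.eigenvalues_mem_spectrum_real i
  obtain ⟨k, hk⟩ := eigenvalue_mem_ball hev
  rw [mem_closedBall_iff_norm, SimpleGraph.adjMatrix_apply, if_neg (G.loopless.irrefl k), sub_zero,
    Real.norm_eq_abs] at hk
  refine hk.trans ?_
  calc ∑ j ∈ univ.erase k, ‖G.adjMatrix ℝ k j‖ ≤ ∑ j, ‖G.adjMatrix ℝ k j‖ :=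
        Finset.sum_le_sum_of_subset_of_nonneg (Finset.subset_univ _) fun _ _ _ => norm_nonneg _
    _ = ∑ j, G.adjMatrix ℝ k j := by
        refine Finset.sum_congr rfl fun j _ => ?_
        rw [SimpleGraph.adjMatrix_apply]
        split_ifs <;> simp
    _ = d := sum_adjMatrix_row G hreg k

theorem Matrix.IsHermitian.inner_eigenvectorBasis_mulVec {ι : Type*} [Fintype ι] [DecidableEq ι]
    {M : Matrix ι ι ℝ} (hM : M.IsHermitian) (i : ι) (w : ι → ℝ) :
    inner ℝ (hM.eigenvectorBasis i) (WithLp.toLp 2 (M.mulVec w)) =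
      hM.eigenvalues i * inner ℝ (hM.eigenvectorBasis i) (WithLp.toLp 2 w) := by
  have hT : M.transpose = M := by
    rw [← Matrix.conjTranspose_eq_transpose_of_trivial]
    exact hM
  have h := hM.mulVec_eigenvectorBasis i
  simp only [EuclideanSpace.inner_eq_star_dotProduct, star_trivial]
  rw [dotProduct_comm, Matrix.dotProduct_mulVec, ← Matrix.mulVec_transpose, hT, h,
    smul_dotProduct, dotProduct_comm, smul_eq_mul]

/-- On vectors orthogonal to the constants, the adjacency form of a regular graph is bounded by
the second largest absolute eigenvalue. -/
theorem abs_dotProduct_adjMatrix_mulVec_le {V : Type*} [Fintype V] [DecidableEq V]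
    [Nonempty V] (G : SimpleGraph V) [DecidableRel G.Adj] {d : ℕ} (hreg : G.IsRegularOfDegree d)
    (u w : V → ℝ) (hu : ∑ x, u x = 0) :
    |u ⬝ᵥ (G.adjMatrix ℝ).mulVec w| ≤
      sndAbsEig G * (√(∑ x, u x ^ 2) * √(∑ x, w x ^ 2)) := by
  set hM := adjMatrix_isHermitian G
  set b := hM.eigenvectorBasis
  set μ := hM.eigenvalues
  set U : EuclideanSpace ℝ V := WithLp.toLp 2 u with hU
  set W : EuclideanSpace ℝ V := WithLp.toLp 2 w with hW
  set e : EuclideanSpace ℝ V := WithLp.toLp 2 (fun _ => (1 : ℝ)) with he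
  have hUe : inner ℝ U e = 0 := by
    simpa [hU, he, EuclideanSpace.inner_eq_star_dotProduct, dotProduct] using hu
  have he0 : e ≠ 0 := by
    intro h
    have := congrArg (fun v : EuclideanSpace ℝ V => v (Classical.arbitrary V)) h
    simp [he] at this
  have hMe : (G.adjMatrix ℝ).mulVec (fun _ => (1 : ℝ)) = (d : ℝ) • (fun _ => (1 : ℝ)) := by
    ext v
    simp [SimpleGraph.adjMatrix_mulVec_apply, hreg v]
  have hbe : ∀ i, inner ℝ (b i) e ≠ 0 → μ i = d := by
    intro i hi
    have h := hM.inner_eigenvectorBasis_mulVec i (fun _ => (1 : ℝ))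
    rw [hMe, WithLp.toLp_smul, inner_smul_right] at h
    exact (mul_right_cancel₀ hi h).symm
  obtain ⟨i₀, hi₀⟩ := exists_forall_ne_abs_eigenvalues_le_sndAbsEig G
  have key : ∀ i, |inner ℝ U (b i) * (μ i * inner ℝ (b i) W)| ≤
      sndAbsEig G * (|inner ℝ U (b i)| * |inner ℝ (b i) W|) := by
    intro i
    rw [abs_mul, abs_mul, mul_left_comm]
    by_cases hle : |μ i| ≤ sndAbsEig G
    · gcongr
    have hii : i = i₀ := by
      by_contra h
      exact hle (hi₀ i h)
    have horth : ∀ j, j ≠ i → inner ℝ (b j) e = 0 := by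
      intro j hj
      by_contra h
      apply hle
      calc |μ i| ≤ d := abs_eigenvalues_adjMatrix_le G hreg i
        _ = μ j := (hbe j h).symm
        _ ≤ |μ j| := le_abs_self _
        _ ≤ _ := hi₀ j (hii ▸ hj)
    have hsum : e = inner ℝ (b i) e • b i := by
      conv_lhs => rw [← b.sum_repr' e]
      exact Finset.sum_eq_single i (fun j _ hj => by rw [horth j hj, zero_smul]) (by simp)
    have hc : inner ℝ (b i) e ≠ 0 := by
      intro h
      rw [h, zero_smul] at hsum
      exact he0 hsum
    have hz : inner ℝ U (b i) = 0 := by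
      rw [hsum, inner_smul_right] at hUe
      exact (mul_eq_zero.1 hUe).resolve_left hc
    simp [hz]
  have hexp : u ⬝ᵥ (G.adjMatrix ℝ).mulVec w =
      ∑ i, inner ℝ U (b i) * (μ i * inner ℝ (b i) W) := by
    have h := b.sum_inner_mul_inner U (WithLp.toLp 2 ((G.adjMatrix ℝ).mulVec w))
    have h' : ∀ i, inner ℝ (b i) (WithLp.toLp 2 ((G.adjMatrix ℝ).mulVec w)) =
      μ i * inner ℝ (b i) W := fun i => hM.inner_eigenvectorBasis_mulVec i w
    simp only [h'] at h
    rw [h, EuclideanSpace.inner_eq_star_dotProduct, star_trivial, dotProduct_comm]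
  have hparU : ∑ i, |inner ℝ U (b i)| ^ 2 = ∑ x, u x ^ 2 := by
    have := b.sum_sq_norm_inner_left U
    simpa [EuclideanSpace.norm_sq_eq, hU] using this
  have hparW : ∑ i, |inner ℝ (b i) W| ^ 2 = ∑ x, w x ^ 2 := by
    have := b.sum_sq_norm_inner_right W
    simpa [EuclideanSpace.norm_sq_eq, hW] using this
  rw [hexp]
  calc _ ≤ ∑ i, |inner ℝ U (b i) * (μ i * inner ℝ (b i) W)| := Finset.abs_sum_le_sum_abs _ _
    _ ≤ ∑ i, sndAbsEig G * (|inner ℝ U (b i)| * |inner ℝ (b i) W|) :=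
        Finset.sum_le_sum fun i _ => key i
    _ = sndAbsEig G * ∑ i, |inner ℝ U (b i)| * |inner ℝ (b i) W| := by rw [Finset.mul_sum]
    _ ≤ _ := by
        refine mul_le_mul_of_nonneg_left ?_ (sndAbsEig_nonneg G)
        rw [← hparU, ← hparW]
        exact Real.sum_mul_le_sqrt_mul_sqrt _ _ _

theorem sum_sq_indicator_sub_density {V : Type*} [Fintype V] [DecidableEq V] [Nonempty V]
    (A : Finset V) :
    ∑ x, ((if x ∈ A then (1 : ℝ) else 0) - A.card / Fintype.card V) ^ 2 =
      A.card * (1 - A.card / Fintype.card V) := by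
  have hn : (Fintype.card V : ℝ) ≠ 0 := by exact_mod_cast Fintype.card_ne_zero
  have h : ∀ x, ((if x ∈ A then (1 : ℝ) else 0) - A.card / Fintype.card V) ^ 2 =
      (if x ∈ A then (1 : ℝ) else 0) * (1 - 2 * (A.card / Fintype.card V)) +
        (A.card / Fintype.card V) ^ 2 := by
    intro x
    split_ifs <;> ring
  simp only [h, Finset.sum_add_distrib, ← Finset.sum_mul, Finset.sum_const, Finset.card_univ,
    nsmul_eq_mul, Finset.sum_boole, Finset.filter_univ_mem]
  field_simp
  ring

theorem dotProduct_adjMatrix_mulVec_indicator_sub_density {V : Type*} [Fintype V]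
    [DecidableEq V] [Nonempty V] (G : SimpleGraph V) [DecidableRel G.Adj] {d : ℕ}
    (hreg : G.IsRegularOfDegree d) (A B : Finset V) :
    (fun x => (if x ∈ A then (1 : ℝ) else 0) - A.card / Fintype.card V) ⬝ᵥ
        (G.adjMatrix ℝ).mulVec
          (fun x => (if x ∈ B then (1 : ℝ) else 0) - B.card / Fintype.card V) =
      eAB G A B - d / Fintype.card V * A.card * B.card := by
  have hn : (Fintype.card V : ℝ) ≠ 0 := by exact_mod_cast Fintype.card_ne_zero
  have hcol : ∑ v, ∑ x ∈ B, G.adjMatrix ℝ v x = d * B.card := by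
    have hcol' : ∀ x, ∑ v, G.adjMatrix ℝ v x = d := fun x => by
      rw [← sum_adjMatrix_row G hreg x]
      exact Finset.sum_congr rfl fun v _ => by simp [SimpleGraph.adjMatrix_apply, G.adj_comm]
    refine Finset.sum_comm.trans ?_
    rw [Finset.sum_congr rfl fun x _ => hcol' x, Finset.sum_const, nsmul_eq_mul, mul_comm]
  have hmul : ∀ v, (G.adjMatrix ℝ).mulVec
      (fun x => (if x ∈ B then (1 : ℝ) else 0) - B.card / Fintype.card V) v =
      ∑ x ∈ B, G.adjMatrix ℝ v x - d * (B.card / Fintype.card V) := by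
    intro v
    simp only [Matrix.mulVec, dotProduct, mul_sub, Finset.sum_sub_distrib, ← Finset.sum_mul,
      sum_adjMatrix_row G hreg, mul_ite, mul_one, mul_zero, Finset.sum_ite_mem, Finset.univ_inter]
  have he : (eAB G A B : ℝ) = ∑ v ∈ A, ∑ x ∈ B, G.adjMatrix ℝ v x := by
    simp [eAB, SimpleGraph.adjMatrix_apply]
  simp only [dotProduct, hmul, sub_mul, Finset.sum_sub_distrib, ← Finset.mul_sum, hcol, ite_mul,
    one_mul, zero_mul, Finset.sum_ite_mem, Finset.univ_inter, Finset.sum_const, Finset.card_univ,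
    nsmul_eq_mul, he]
  field_simp
  ring

theorem expander_mixing_lemma
    {V : Type*} [Fintype V] [DecidableEq V] (G : SimpleGraph V) [DecidableRel G.Adj]
    (n d : ℕ) (lam : ℝ) (hn : Fintype.card V = n)
    (hreg : G.IsRegularOfDegree d) (hlam : sndAbsEig G ≤ lam)
    (A B : Finset V) :
    |(eAB G A B : ℝ) - (d : ℝ) / (n : ℝ) * (A.card : ℝ) * (B.card : ℝ)| ≤
      lam * Real.sqrt ((A.card : ℝ) * (B.card : ℝ) *
        (1 - (A.card : ℝ) / (n : ℝ)) * (1 - (B.card : ℝ) / (n : ℝ))) := by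
  subst hn
  cases isEmpty_or_nonempty V
  · simp [Finset.eq_empty_of_isEmpty A, eAB]
  have hn : (Fintype.card V : ℝ) ≠ 0 := by exact_mod_cast Fintype.card_ne_zero
  have h := abs_dotProduct_adjMatrix_mulVec_le G hreg
    (fun x => (if x ∈ A then (1 : ℝ) else 0) - A.card / Fintype.card V)
    (fun x => (if x ∈ B then (1 : ℝ) else 0) - B.card / Fintype.card V)
    (by simp [Finset.sum_sub_distrib, mul_div_cancel₀, hn])
  rw [dotProduct_adjMatrix_mulVec_indicator_sub_density G hreg,
    ← Real.sqrt_mul (Finset.sum_nonneg fun _ _ => sq_nonneg _),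
    sum_sq_indicator_sub_density, sum_sq_indicator_sub_density, mul_mul_mul_comm,
    ← mul_assoc] at h
  exact h.trans (mul_le_mul_of_nonneg_right hlam (Real.sqrt_nonneg _))
end

section
/- Let x_1, ..., x_c be positive integers such that x_1 + ... + x_c ≤ 2c − 1. Then for every integer ℓ with 0 ≤ ℓ ≤ x_1 + ... + x_c, there exists a subset I ⊆ {1, ..., c} such that Σ_{i∈I} x_i = ℓ. -/
open Finset

/-- If positive integers indexed by `s` have sum at most `2 * #s - 1`, then every value up to their
total is the sum over some subset of `s`. -/
theorem exists_subset_sum_eq_of_sum_le {ι : Type*} (x : ι → ℕ) (s : Finset ι)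
    (hx : ∀ i ∈ s, 0 < x i) (hsum : ∑ i ∈ s, x i ≤ 2 * #s - 1)
    {l : ℕ} (hl : l ≤ ∑ i ∈ s, x i) :
    ∃ t ⊆ s, ∑ i ∈ t, x i = l := by
  classical
  induction s using Finset.induction_on_max_value x generalizing l with
  | empty => exact ⟨∅, subset_rfl, by simpa [eq_comm] using hl⟩
  | insert a s ha hmax ih =>
    rw [sum_insert ha, card_insert_of_notMem ha] at hsum
    rw [sum_insert ha] at hl
    have hpos : 0 < x a := hx a (mem_insert_self a s)
    have hx' : ∀ i ∈ s, 0 < x i := fun i hi => hx i (mem_insert_of_mem hi)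
    have hlower : #s ≤ ∑ i ∈ s, x i := by
      simpa using card_nsmul_le_sum s x 1 hx'
    have hupper : ∑ i ∈ s, x i ≤ #s * x a := by
      simpa using sum_le_card_nsmul s x (x a) hmax
    have hsum' : ∑ i ∈ s, x i ≤ 2 * #s - 1 := by
      rcases Nat.lt_or_ge (x a) 2 with h | h
      · have h1 : x a = 1 := by omega
        rw [h1] at hupper
        omega
      · omega
    rcases le_or_gt l (∑ i ∈ s, x i) with h | h
    · obtain ⟨t, hts, ht⟩ := ih hx' hsum' h
      exact ⟨t, hts.trans (subset_insert a s), ht⟩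
    · obtain ⟨t, hts, ht⟩ := ih hx' hsum' (l := l - x a) (by omega)
      refine ⟨insert a t, insert_subset_insert a hts, ?_⟩
      rw [sum_insert fun hat => ha (hts hat), ht]
      omega

theorem subset_sums_all_values (c : ℕ) (hc : 0 < c) (x : Fin c → ℕ)
    (hx : ∀ i, 0 < x i) (hsum : ∑ i, x i ≤ 2 * c - 1)
    (ℓ : ℕ) (hℓ : ℓ ≤ ∑ i, x i) :
    ∃ I : Finset (Fin c), ∑ i ∈ I, x i = ℓ := by
  obtain ⟨I, -, hI⟩ := exists_subset_sum_eq_of_sum_le x univ (fun i _ => hx i)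
    (by simpa using hsum) hℓ
  exact ⟨I, hI⟩
end

section
/- Let G be a connected d-regular graph on n vertices with second largest absolute adjacency eigenvalue λ > 0, and let S be a proper subset of V(G) with c(G − S) > 1. If |V(G) \ S| ≤ 2λn/(d + λ), then |S|/c(G − S) ≥ d/λ − 1. -/
open Finset

theorem neg_sndAbsEig_le_eigenvalues {V : Type*} [Fintype V] [DecidableEq V] (G : SimpleGraph V)
    [DecidableRel G.Adj] (hV : 1 < Fintype.card V) (i : V) :
    -sndAbsEig G ≤ (adjMatrix_isHermitian G).eigenvalues i := by
  have le_foldr_max : ∀ (l : List ℝ) (a : ℝ), a ∈ l → a ≤ l.foldr max 0 := by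
    intro l a ha
    induction l with
    | nil => simp at ha
    | cons b l ih =>
      rcases List.mem_cons.1 ha with rfl | h
      · exact le_max_left _ _
      · exact (ih h).trans (le_max_right _ _)
  unfold sndAbsEig
  set s := Multiset.map (adjMatrix_isHermitian G).eigenvalues Finset.univ.val with hs
  have hi : (adjMatrix_isHermitian G).eigenvalues i ∈ s.sort (· ≤ ·) := by
    simp [hs]
  have hlen : 1 < (s.sort (· ≤ ·)).length := by
    simpa [hs] using hV
  have hsort := s.pairwise_sort (· ≤ ·)
  generalize s.sort (· ≤ ·) = l at *
  match l, hlen with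
  | a :: b :: t, _ =>
    have ha : a ≤ (adjMatrix_isHermitian G).eigenvalues i := by
      rcases List.mem_cons.1 hi with h | h
      · exact h.ge
      · exact (List.pairwise_cons.1 hsort).1 _ h
    have := le_foldr_max (((a :: b :: t).dropLast).map (fun x => |x|)) |a| (by simp)
    linarith [neg_abs_le a]

theorem dotProduct_adjMatrix_mulVec_ge {V : Type*} [Fintype V] [DecidableEq V]
    (G : SimpleGraph V) [DecidableRel G.Adj] (hV : 1 < Fintype.card V) (x : V → ℝ) :
    -sndAbsEig G * (x ⬝ᵥ x) ≤ x ⬝ᵥ (G.adjMatrix ℝ).mulVec x := by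
  have hpsd : (G.adjMatrix ℝ + algebraMap ℝ (Matrix V V ℝ) (sndAbsEig G)).PosSemidef := by
    rw [Matrix.posSemidef_iff_isHermitian_and_spectrum_nonneg]
    refine ⟨(adjMatrix_isHermitian G).add ?_, ?_⟩
    · rw [Matrix.algebraMap_eq_diagonal]
      exact Matrix.isHermitian_diagonal _
    · rw [← spectrum.add_singleton_eq, (adjMatrix_isHermitian G).spectrum_real_eq_range_eigenvalues]
      rintro _ ⟨_, ⟨i, rfl⟩, _, rfl, rfl⟩
      have := neg_sndAbsEig_le_eigenvalues G hV i
      simp only [Set.mem_ofPred_eq]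
      linarith
  have := hpsd.dotProduct_mulVec_nonneg x
  rw [Matrix.add_mulVec, dotProduct_add, Algebra.algebraMap_eq_smul_one, Matrix.smul_mulVec,
    Matrix.one_mulVec, dotProduct_smul] at this
  simp only [star_trivial, smul_eq_mul] at this
  linarith

/-- The ratio bound of Hoffman. -/
theorem card_mul_le_of_isIndepSet {V : Type*} [Fintype V] [DecidableEq V]
    (G : SimpleGraph V) [DecidableRel G.Adj] {d : ℕ} (hV : 1 < Fintype.card V)
    (hreg : G.IsRegularOfDegree d) (I : Finset V) (hI : G.IsIndepSet I) (hne : I.Nonempty) :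
    (I.card : ℝ) * (d + sndAbsEig G) ≤ sndAbsEig G * Fintype.card V := by
  set n : ℝ := (Fintype.card V : ℝ) with hn
  set c : ℝ := (I.card : ℝ) with hc
  set A := G.adjMatrix ℝ with hA
  set x : V → ℝ := fun v => if v ∈ I then 1 else 0 with hx
  set u : V → ℝ := fun _ => 1 with hu
  have hAu : A.mulVec u = (d : ℝ) • u := by
    ext v
    simp [hA, hu, SimpleGraph.adjMatrix_mulVec_apply, hreg v]
  have hxx : x ⬝ᵥ x = c := by simp [dotProduct, hx, hc]
  have hxu : x ⬝ᵥ u = c := by simp [dotProduct, hx, hu, hc]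
  have huu : u ⬝ᵥ u = n := by simp [dotProduct, hu, hn]
  have huAx : u ⬝ᵥ A.mulVec x = d * c := by
    rw [Matrix.dotProduct_mulVec, ← Matrix.mulVec_transpose, hA, SimpleGraph.transpose_adjMatrix,
      ← hA, hAu, smul_dotProduct, dotProduct_comm, hxu, smul_eq_mul]
  have hxAx : x ⬝ᵥ A.mulVec x = 0 := by
    refine Finset.sum_eq_zero fun v _ => ?_
    by_cases hv : v ∈ I
    · rw [hA, SimpleGraph.adjMatrix_mulVec_apply, Finset.sum_eq_zero, mul_zero]
      intro w hw
      have hvw := (G.mem_neighborFinset v w).1 hw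
      simp only [hx, ite_eq_right_iff, one_ne_zero, imp_false]
      exact fun hwI => hI hv hwI hvw.ne hvw
    · simp [hx, hv]
  have key := dotProduct_adjMatrix_mulVec_ge G hV (n • x - c • u)
  simp only [← hA, Matrix.mulVec_sub, Matrix.mulVec_smul, hAu, sub_dotProduct, dotProduct_sub,
    smul_dotProduct, dotProduct_smul, dotProduct_comm u x, hxx, hxu, huu, huAx, hxAx,
    smul_eq_mul] at key
  have hcpos : 0 < c := by rw [hc]; exact_mod_cast hne.card_pos
  have hnpos : 0 < n := by rw [hn]; exact_mod_cast (by omega : 0 < Fintype.card V)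
  refine le_of_mul_le_mul_left ?_ (mul_pos hnpos hcpos)
  linarith

theorem exists_isIndepSet_card_eq_numComp {V : Type*} [Fintype V] [DecidableEq V]
    (G : SimpleGraph V) (S : Finset V) :
    ∃ I : Finset V, G.IsIndepSet I ∧ I.card = numComp G S := by
  classical
  let H := G.induce ((Sᶜ : Finset V) : Set V)
  have hout : ∀ C : H.ConnectedComponent, H.connectedComponentMk C.out = C := Quot.out_eq
  have hinj : Function.Injective fun C : H.ConnectedComponent => (C.out : V) := by
    intro C D h
    rw [← hout C, ← hout D, Subtype.ext h]
  refine ⟨Finset.univ.image fun C : H.ConnectedComponent => (C.out : V), ?_, ?_⟩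
  · intro v hv w hw hne hadj
    simp only [Finset.coe_image, Finset.coe_univ, Set.image_univ, Set.mem_range] at hv hw
    obtain ⟨C, rfl⟩ := hv
    obtain ⟨D, rfl⟩ := hw
    have hCD : H.Adj C.out D.out := hadj
    have : C = D := by
      rw [← hout C, ← hout D]
      exact SimpleGraph.ConnectedComponent.sound hCD.reachable
    exact hne (by rw [this])
  · rw [Finset.card_image_of_injective _ hinj, Finset.card_univ, numComp, Nat.card_eq_fintype_card]

theorem toughness_bound_small_complement
    {V : Type*} [Fintype V] [DecidableEq V] (G : SimpleGraph V) [DecidableRel G.Adj]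
    (n d : ℕ) (hn : Fintype.card V = n)
    (hconn : G.Connected) (hreg : G.IsRegularOfDegree d)
    (hlam : 0 < sndAbsEig G)
    (S : Finset V) (hS : S ⊂ Finset.univ) (hc : 1 < numComp G S)
    (hB : ((Sᶜ : Finset V).card : ℝ) ≤ 2 * sndAbsEig G * (n : ℝ) / ((d : ℝ) + sndAbsEig G)) :
    (S.card : ℝ) / (numComp G S : ℝ) ≥ (d : ℝ) / sndAbsEig G - 1 := by
  subst hn
  obtain ⟨I, hI, hcard⟩ := exists_isIndepSet_card_eq_numComp G S
  rw [← hcard] at hc ⊢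
  have hoff := card_mul_le_of_isIndepSet G (hc.trans_le I.card_le_univ) hreg I hI
    (Finset.card_pos.1 (by omega))
  have hS' : (S.card : ℝ) + (Sᶜ : Finset V).card = Fintype.card V := by
    exact_mod_cast S.card_add_card_compl
  have hcpos : (0 : ℝ) < I.card := by exact_mod_cast (by omega : 0 < I.card)
  have hdl : 0 < (d : ℝ) + sndAbsEig G := by positivity
  rw [le_div_iff₀ hdl] at hB
  rw [ge_iff_le, div_sub_one hlam.ne']
  rcases le_total (d : ℝ) (sndAbsEig G) with h | h
  · exact (div_nonpos_of_nonpos_of_nonneg (by linarith) hlam.le).trans (by positivity)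
  · rw [div_le_div_iff₀ hlam hcpos]
    refine le_of_mul_le_mul_right ?_ hdl
    have h1 := mul_le_mul_of_nonneg_left hoff (sub_nonneg.2 h)
    have h2 := mul_le_mul_of_nonneg_left hB hlam.le
    rw [← hS'] at h1 h2
    linarith
end
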